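/- Suppose ℓ ≥ max{|s−p|, p, 1}, so that 𝓛 = 𝓛₀ + 𝓛₁ : H^s → H^{s−k} is bounded. For ε > 0, let σ_ε(𝓛; H^s, H^{s−k}) be the closure of the set of z ∈ ℂ such that z id − 𝓛 : H^s → H^{s−k} either fails to be boundedly invertible or satisfies ‖(z id − 𝓛)^{−1}‖_{H^{s−k}→H^s} > ε^{−1}, and let ρ_ε(𝓛) be the complement of σ_ε(𝓛; H^s, H^{s−k}). Then there exists a constant c = c(𝓛, s) > 0 such that whenever N > c·ε^{1/(p−k)}, no eigenvalue of the finite-dimensional operator 𝓛₀ + 𝒫_N𝓛₁ restricted to ran 𝒫_N lies in ρ_ε(𝓛). -/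

import Mathlib

noncomputable section

open scoped BigOperators

/-- The Sobolev weight `max(1,|j|)`. -/
def wt (j : ℤ) : ℝ := max 1 |(j : ℝ)|

/-- Membership of a two-sided sequence in the Sobolev space `H^s`. -/
def hsumm (s : ℝ) (u : ℤ → ℂ) : Prop :=
  Summable fun j : ℤ => ‖u j‖ ^ 2 * wt j ^ (2 * s)

/-- The `H^s` norm of a two-sided sequence. -/
def hnorm (s : ℝ) (u : ℤ → ℂ) : ℝ :=
  Real.sqrt (∑' j : ℤ, ‖u j‖ ^ 2 * wt j ^ (2 * s))

/-- `N₋ = ⌊N/2⌋`. -/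
def Nmin (N : ℕ) : ℤ := (N : ℤ) / 2

/-- `N₊ = ⌊(N-1)/2⌋`. -/
def Npl (N : ℕ) : ℤ := ((N : ℤ) - 1) / 2

/-- The Fourier truncation projection `𝒫_N`. -/
def projP (N : ℕ) (u : ℤ → ℂ) : ℤ → ℂ :=
  fun j => if -Nmin N ≤ j ∧ j ≤ Npl N then u j else 0

/-- The trigonometric interpolation projection `𝓘_N` (via the aliasing formula). -/
def interpI (N : ℕ) (u : ℤ → ℂ) : ℤ → ℂ :=
  fun j => if -Nmin N ≤ j ∧ j ≤ Npl N then ∑' p : ℤ, u (p * (N : ℤ) + j) else 0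

/-- Membership in `ran 𝒫_N`. -/
def inPN (N : ℕ) (u : ℤ → ℂ) : Prop := projP N u = u

/-- The symbol `m(j) = Σ_{r=q}^k c_r (i j)^r` of the constant-coefficient part `𝓛₀`. -/
def symb (q k : ℕ) (c : ℕ → ℂ) (j : ℤ) : ℂ :=
  ∑ r ∈ Finset.Icc q k, c r * (Complex.I * (j : ℂ)) ^ r

/-- The constant-coefficient operator `𝓛₀`, a Fourier multiplier with symbol `m(j)`. -/
def L0op (q k : ℕ) (c : ℕ → ℂ) (u : ℤ → ℂ) : ℤ → ℂ :=
  fun j => symb q k c j * u j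

/-- The variable-coefficient lower-order part `𝓛₁ u = Σ_{r=0}^p a_r · d^r u/dθ^r`,
acting on Fourier coefficients. -/
def L1op (p : ℕ) (a : ℕ → ℤ → ℂ) (u : ℤ → ℂ) : ℤ → ℂ :=
  fun n => ∑ r ∈ Finset.range (p + 1), ∑' j : ℤ, a r (n - j) * (Complex.I * (j : ℂ)) ^ r * u j

/-- The regulator `𝓝 = (𝓛₀ - ζ id)⁻¹`, a Fourier multiplier with symbol `(m(j) - ζ)⁻¹`. -/
def Nop (q k : ℕ) (c : ℕ → ℂ) (ζ : ℂ) (u : ℤ → ℂ) : ℤ → ℂ :=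
  fun j => (symb q k c j - ζ)⁻¹ * u j

/-- The condition `inf_j |m(j) - ζ| max(1,|j|)^{-k} > 0` on the regularization point `ζ`. -/
def zetaGood (q k : ℕ) (c : ℕ → ℂ) (ζ : ℂ) : Prop :=
  ∃ ε : ℝ, 0 < ε ∧ ∀ j : ℤ, ε ≤ ‖symb q k c j - ζ‖ * wt j ^ (-(k : ℝ))

/-- The operator norm of a map `T : H^s → H^t`, as the least admissible bound. -/
def opNorm (s t : ℝ) (T : (ℤ → ℂ) → (ℤ → ℂ)) : ℝ :=
  sInf {C : ℝ | 0 ≤ C ∧ ∀ u : ℤ → ℂ, hsumm s u → hnorm t (T u) ≤ C * hnorm s u}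

/-- `z id - 𝓛 : H^s → H^{s-k}` is boundedly invertible with
`‖(z id - 𝓛)^{-1}‖_{H^{s-k} → H^s} ≤ ε⁻¹`. -/
def resolventBounded (q k p : ℕ) (c : ℕ → ℂ) (a : ℕ → ℤ → ℂ) (s : ℝ) (ε : ℝ) (z : ℂ) : Prop :=
  ∃ R : (ℤ → ℂ) → (ℤ → ℂ),
    (∀ f : ℤ → ℂ, hsumm (s - (k : ℝ)) f →
      hsumm s (R f) ∧ z • R f - (L0op q k c (R f) + L1op p a (R f)) = f) ∧
    (∀ u : ℤ → ℂ, hsumm s u → R (z • u - (L0op q k c u + L1op p a u)) = u) ∧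
    opNorm (s - (k : ℝ)) s R ≤ ε⁻¹

open scoped ENNReal NNReal

/-- The squared `H^t` norm of a sequence, with values in `[0, ∞]`. -/
def sobSq (t : ℝ) (u : ℤ → ℂ) : ℝ≥0∞ :=
  ∑' j : ℤ, (ENNReal.ofReal (wt j ^ t) * ‖u j‖ₑ) ^ 2

lemma one_le_wt (j : ℤ) : 1 ≤ wt j := le_max_left _ _

lemma wt_pos (j : ℤ) : 0 < wt j := zero_lt_one.trans_le (one_le_wt j)

lemma abs_le_wt (j : ℤ) : |(j : ℝ)| ≤ wt j := le_max_right _ _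

lemma wt_le_add (n j : ℤ) : wt n ≤ wt (n - j) + wt j := by
  refine max_le (by linarith [one_le_wt (n - j), one_le_wt j]) ?_
  have h := abs_add_le ((n : ℝ) - j) j
  have h1 := abs_le_wt (n - j)
  push_cast at h1
  rw [sub_add_cancel] at h
  linarith [abs_le_wt j]

lemma wt_sub_comm (n j : ℤ) : wt (n - j) = wt (j - n) := by
  unfold wt
  push_cast
  rw [abs_sub_comm]

lemma sq_enorm_weight_eq (t : ℝ) (u : ℤ → ℂ) (j : ℤ) :
    (ENNReal.ofReal (wt j ^ t) * ‖u j‖ₑ) ^ 2 =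
      ENNReal.ofReal (‖u j‖ ^ 2 * wt j ^ (2 * t)) := by
  have hw : 0 ≤ wt j ^ t := Real.rpow_nonneg (wt_pos j).le t
  rw [← ofReal_norm, ← ENNReal.ofReal_mul hw, ← ENNReal.ofReal_pow (by positivity)]
  congr 1
  rw [mul_comm 2 t, Real.rpow_mul (wt_pos j).le, Real.rpow_two]
  ring

lemma weighted_sq_nonneg (t : ℝ) (u : ℤ → ℂ) (j : ℤ) : 0 ≤ ‖u j‖ ^ 2 * wt j ^ (2 * t) :=
  mul_nonneg (sq_nonneg _) (Real.rpow_nonneg (wt_pos j).le _)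

lemma hsumm_iff_sobSq_ne_top {t : ℝ} {u : ℤ → ℂ} : hsumm t u ↔ sobSq t u ≠ ⊤ := by
  unfold hsumm sobSq
  simp_rw [sq_enorm_weight_eq]
  refine ⟨fun h => h.tsum_ofReal_ne_top, fun h => ?_⟩
  have := ENNReal.summable_toReal h
  refine this.congr fun j => ?_
  exact ENNReal.toReal_ofReal (weighted_sq_nonneg t u j)

lemma hnorm_eq_sqrt_sobSq (t : ℝ) (u : ℤ → ℂ) : hnorm t u = Real.sqrt (sobSq t u).toReal := by
  unfold hnorm sobSq
  simp_rw [sq_enorm_weight_eq]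
  rw [ENNReal.tsum_toReal_eq (fun _ => ENNReal.ofReal_ne_top)]
  congr 1
  exact tsum_congr fun j => (ENNReal.toReal_ofReal (weighted_sq_nonneg t u j)).symm

lemma hnorm_le_of_sobSq_le {s t : ℝ} {u v : ℤ → ℂ} {M : ℝ} (hM : 0 ≤ M) (hv : hsumm s v)
    (h : sobSq t u ≤ ENNReal.ofReal (M ^ 2) * sobSq s v) : hnorm t u ≤ M * hnorm s v := by
  rw [hnorm_eq_sqrt_sobSq, hnorm_eq_sqrt_sobSq, ← Real.sqrt_sq hM, ← Real.sqrt_mul (sq_nonneg M)]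
  apply Real.sqrt_le_sqrt
  have h' := ENNReal.toReal_mono
    (ENNReal.mul_ne_top ENNReal.ofReal_ne_top (hsumm_iff_sobSq_ne_top.1 hv)) h
  rwa [ENNReal.toReal_mul, ENNReal.toReal_ofReal (sq_nonneg M)] at h'

lemma ENNReal.tsum_mul_sq_le {ι : Type*} (f g : ι → ℝ≥0∞) :
    (∑' j, f j * g j) ^ 2 ≤ (∑' j, f j ^ 2) * ∑' j, g j ^ 2 := by
  have key : ∑' j, f j * g j ≤ ((∑' j, f j ^ 2) * ∑' j, g j ^ 2) ^ (1 / 2 : ℝ) := by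
    rw [ENNReal.tsum_eq_iSup_sum]
    refine iSup_le fun S => ?_
    refine (ENNReal.inner_le_Lp_mul_Lq S f g Real.HolderConjugate.two_two).trans ?_
    rw [ENNReal.mul_rpow_of_nonneg _ _ (by norm_num)]
    simp only [ENNReal.rpow_two]
    gcongr <;> exact ENNReal.sum_le_tsum S
  calc (∑' j, f j * g j) ^ 2 ≤ (((∑' j, f j ^ 2) * ∑' j, g j ^ 2) ^ (1 / 2 : ℝ)) ^ 2 := by gcongr
    _ = _ := by
      rw [← ENNReal.rpow_natCast, ← ENNReal.rpow_mul]
      norm_num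

lemma ENNReal.add_sq_le_two_mul (x y : ℝ≥0∞) : (x + y) ^ 2 ≤ 2 * (x ^ 2 + y ^ 2) := by
  have h := ENNReal.rpow_add_le_mul_rpow_add_rpow x y (p := 2) (by norm_num)
  have h2 : (2 : ℝ) - 1 = 1 := by norm_num
  simpa only [ENNReal.rpow_two, h2, ENNReal.rpow_one] using h

lemma ENNReal.tsum_conv_sq {α ω : ℤ → ℝ≥0∞} :
    ∑' n, ∑' j, (α (n - j) * ω j) ^ 2 = (∑' j, α j ^ 2) * ∑' j, ω j ^ 2 := by
  rw [ENNReal.tsum_comm, ← ENNReal.tsum_mul_left]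
  refine tsum_congr fun j => ?_
  simp_rw [mul_pow]
  rw [ENNReal.tsum_mul_right]
  congr 1
  exact (Equiv.subRight j).tsum_eq (fun n => α n ^ 2)

lemma tsum_weighted_conv_sq_le (α ω γ : ℤ → ℝ≥0∞) :
    ∑' n, (∑' j, α (n - j) * ω j * (γ (n - j) + γ j + γ n)) ^ 2 ≤
      10 * ((∑' j, γ j ^ 2) * ((∑' j, α j ^ 2) * ∑' j, ω j ^ 2)) := by
  set Γ := ∑' j, γ j ^ 2 with hΓ
  set P := (∑' j, α j ^ 2) * ∑' j, ω j ^ 2 with hP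
  have hshift : ∀ n : ℤ, ∑' j, γ (n - j) ^ 2 = Γ := fun n =>
    (Equiv.subLeft n).tsum_eq (fun j => γ j ^ 2)
  have hpoint : ∀ n, (∑' j, α (n - j) * ω j * (γ (n - j) + γ j + γ n)) ^ 2 ≤
      4 * Γ * ∑' j, (α (n - j) * ω j) ^ 2 + 4 * (Γ * ∑' j, (α (n - j) * ω j) ^ 2) +
        2 * (γ n ^ 2 * P) := by
    intro n
    have h₁ := ENNReal.tsum_mul_sq_le (fun j => γ (n - j)) (fun j => α (n - j) * ω j)
    have h₂ := ENNReal.tsum_mul_sq_le γ (fun j => α (n - j) * ω j)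
    have h₃ := ENNReal.tsum_mul_sq_le (fun j => α (n - j)) ω
    have hα : ∑' j, α (n - j) ^ 2 = ∑' j, α j ^ 2 :=
      (Equiv.subLeft n).tsum_eq (fun j => α j ^ 2)
    rw [hα] at h₃
    rw [hshift] at h₁
    have hsplit : ∑' j, α (n - j) * ω j * (γ (n - j) + γ j + γ n) =
        (∑' j, γ (n - j) * (α (n - j) * ω j) + ∑' j, γ j * (α (n - j) * ω j)) +
          γ n * ∑' j, α (n - j) * ω j := by
      rw [← ENNReal.tsum_mul_left, ← ENNReal.tsum_add, ← ENNReal.tsum_add]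
      exact tsum_congr fun j => by ring
    rw [hsplit]
    refine (ENNReal.add_sq_le_two_mul _ _).trans ?_
    calc _ ≤ 2 * (2 * (Γ * ∑' j, (α (n - j) * ω j) ^ 2 + Γ * ∑' j, (α (n - j) * ω j) ^ 2) +
          γ n ^ 2 * P) := by
          gcongr
          · refine (ENNReal.add_sq_le_two_mul _ _).trans ?_
            gcongr
          · rw [mul_pow]
            gcongr
      _ = _ := by ring
  refine (ENNReal.tsum_le_tsum hpoint).trans ?_
  rw [ENNReal.tsum_add, ENNReal.tsum_add]
  simp only [ENNReal.tsum_mul_left, ENNReal.tsum_mul_right, ENNReal.tsum_conv_sq]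
  rw [← hΓ, ← hP]
  apply le_of_eq
  ring

lemma rpow_le_mul_of_le_add {x y z l t : ℝ} (hx : 0 < x) (hy : 1 ≤ y) (hz : 1 ≤ z)
    (hxyz : x ≤ y + z) (hl : 1 ≤ l) (ht : 0 ≤ t) (htl : t ≤ l) :
    x ^ t ≤ 2 ^ t * (y ^ l * z ^ t) * (y⁻¹ + z⁻¹) := by
  have hy0 : 0 < y := by linarith
  have hz0 : 0 < z := by linarith
  rcases le_total y z with h | h
  · calc x ^ t ≤ (2 * z) ^ t := by
          apply Real.rpow_le_rpow hx.le _ ht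
          linarith
      _ = 2 ^ t * (1 * z ^ t) := by rw [Real.mul_rpow (by norm_num) hz0.le, one_mul]
      _ ≤ 2 ^ t * ((y ^ l * y⁻¹) * z ^ t) := by
          gcongr
          rw [← div_eq_mul_inv, one_le_div hy0]
          exact Real.self_le_rpow_of_one_le hy hl
      _ = 2 ^ t * (y ^ l * z ^ t) * y⁻¹ := by ring
      _ ≤ _ := by
          gcongr
          exact le_add_of_nonneg_right (by positivity)
  · have key : y ^ t * z ≤ y ^ l * z ^ t := by
      have h1 : z ^ (1 - t) ≤ y ^ (l - t) := by
        rcases le_total 1 t with h1 | h1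
        · exact (Real.rpow_le_one_of_one_le_of_nonpos hz (by linarith)).trans
            (Real.one_le_rpow hy (by linarith))
        · exact (Real.rpow_le_rpow hz0.le h (by linarith)).trans
            (Real.rpow_le_rpow_of_exponent_le hy (by linarith))
      calc y ^ t * z = y ^ t * (z ^ (1 - t) * z ^ t) := by
            rw [← Real.rpow_add hz0, sub_add_cancel, Real.rpow_one]
        _ ≤ y ^ t * (y ^ (l - t) * z ^ t) := by gcongr
        _ = y ^ l * z ^ t := by
            rw [← mul_assoc, ← Real.rpow_add hy0, add_sub_cancel]
    calc x ^ t ≤ (2 * y) ^ t := by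
          apply Real.rpow_le_rpow hx.le _ ht
          linarith
      _ = 2 ^ t * (y ^ t * z) * z⁻¹ := by
          rw [Real.mul_rpow (by norm_num) hy0.le]
          field_simp
      _ ≤ 2 ^ t * (y ^ l * z ^ t) * z⁻¹ := by gcongr
      _ ≤ _ := by
          gcongr
          exact le_add_of_nonneg_left (by positivity)

lemma wt_rpow_le {l t : ℝ} (hl : 1 ≤ l) (htl : |t| ≤ l) (n j : ℤ) :
    wt n ^ t ≤ 2 ^ |t| * (wt (n - j) ^ l * wt j ^ t) *
      ((wt (n - j))⁻¹ + (wt j)⁻¹ + (wt n)⁻¹) := by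
  have hn := wt_pos n
  have hj := wt_pos j
  have hnj := wt_pos (n - j)
  rcases le_total 0 t with ht | ht
  · rw [abs_of_nonneg ht] at htl ⊢
    refine (rpow_le_mul_of_le_add hn (one_le_wt _) (one_le_wt _) (wt_le_add n j) hl ht htl).trans ?_
    refine mul_le_mul_of_nonneg_left ?_ (by positivity)
    exact le_add_of_nonneg_right (by positivity)
  · rw [abs_of_nonpos ht] at htl ⊢
    have h := rpow_le_mul_of_le_add hj (one_le_wt (j - n)) (one_le_wt n) (wt_le_add j n) hl
      (neg_nonneg.2 ht) htl
    rw [wt_sub_comm j n] at h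
    have hmul : ∀ i : ℤ, wt i ^ (-t) * wt i ^ t = 1 := fun i => by
      rw [← Real.rpow_add (wt_pos i), neg_add_cancel, Real.rpow_zero]
    calc wt n ^ t = wt j ^ (-t) * (wt j ^ t * wt n ^ t) := by
          rw [← mul_assoc, hmul, one_mul]
      _ ≤ 2 ^ (-t) * (wt (n - j) ^ l * wt n ^ (-t)) * ((wt (n - j))⁻¹ + (wt n)⁻¹) *
            (wt j ^ t * wt n ^ t) := by gcongr
      _ = 2 ^ (-t) * (wt (n - j) ^ l * wt j ^ t) * ((wt (n - j))⁻¹ + (wt n)⁻¹) *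
            (wt n ^ (-t) * wt n ^ t) := by ring
      _ = 2 ^ (-t) * (wt (n - j) ^ l * wt j ^ t) * ((wt (n - j))⁻¹ + (wt n)⁻¹) := by
          rw [hmul, mul_one]
      _ ≤ _ := by
          gcongr
          exact le_add_of_nonneg_right (by positivity)

lemma tsum_ofReal_inv_wt_sq_ne_top : ∑' j : ℤ, ENNReal.ofReal (wt j)⁻¹ ^ 2 ≠ ⊤ := by
  have hs : Summable fun j : ℤ => 1 / (j : ℝ) ^ 2 :=
    Real.summable_one_div_int_pow.2 (by norm_num)
  have hw : Summable fun j : ℤ => ((wt j)⁻¹) ^ 2 := by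
    refine (hs.add (hasSum_ite_eq (0 : ℤ) (1 : ℝ)).summable).of_nonneg_of_le
      (fun j => by positivity) fun j => ?_
    by_cases h : j = 0
    · simp [h, wt]
    · have h0 : 0 < |(j : ℝ)| := by positivity
      simp only [h, if_false, add_zero, inv_pow, one_div, ← sq_abs (j : ℝ)]
      gcongr
      exact abs_le_wt j
  have h := hw.tsum_ofReal_ne_top
  simpa only [ENNReal.ofReal_pow (inv_nonneg.2 (wt_pos _).le)] using h

/-- Multiplication by a function in `H^l` is bounded on `H^t` for `|t| ≤ l` and `1 ≤ l`. -/
lemma exists_tsum_conv_le {l t : ℝ} (hl : 1 ≤ l) (htl : |t| ≤ l) {b : ℤ → ℂ}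
    (hb : hsumm l b) :
    ∃ C : ℝ≥0, ∀ w : ℤ → ℂ,
      ∑' n, (ENNReal.ofReal (wt n ^ t) * ∑' j, ‖b (n - j) * w j‖ₑ) ^ 2 ≤ C * sobSq t w := by
  set Γ := ∑' j : ℤ, ENNReal.ofReal (wt j)⁻¹ ^ 2 with hΓ
  set D : ℝ≥0∞ := ENNReal.ofReal (2 ^ |t|) with hD
  have hC : D ^ 2 * (10 * (Γ * sobSq l b)) ≠ ⊤ := by
    refine ENNReal.mul_ne_top (ENNReal.pow_ne_top ENNReal.ofReal_ne_top) ?_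
    refine ENNReal.mul_ne_top (by norm_num) ?_
    exact ENNReal.mul_ne_top tsum_ofReal_inv_wt_sq_ne_top (hsumm_iff_sobSq_ne_top.1 hb)
  refine ⟨(D ^ 2 * (10 * (Γ * sobSq l b))).toNNReal, fun w => ?_⟩
  rw [ENNReal.coe_toNNReal hC]
  have h := tsum_weighted_conv_sq_le (fun j => ENNReal.ofReal (wt j ^ l) * ‖b j‖ₑ)
    (fun j => ENNReal.ofReal (wt j ^ t) * ‖w j‖ₑ) (fun j => ENNReal.ofReal (wt j)⁻¹)
  have hpoint : ∀ n : ℤ, (ENNReal.ofReal (wt n ^ t) * ∑' j, ‖b (n - j) * w j‖ₑ) ^ 2 ≤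
      D ^ 2 * (∑' j, (ENNReal.ofReal (wt (n - j) ^ l) * ‖b (n - j)‖ₑ) *
        (ENNReal.ofReal (wt j ^ t) * ‖w j‖ₑ) * (ENNReal.ofReal (wt (n - j))⁻¹ +
          ENNReal.ofReal (wt j)⁻¹ + ENNReal.ofReal (wt n)⁻¹)) ^ 2 := by
    intro n
    rw [← mul_pow, ← ENNReal.tsum_mul_left, ← ENNReal.tsum_mul_left]
    refine pow_le_pow_left' (ENNReal.tsum_le_tsum fun j => ?_) 2
    have hi : ∀ i : ℤ, 0 ≤ (wt i)⁻¹ := fun i => inv_nonneg.2 (wt_pos i).le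
    have hr : ∀ (i : ℤ) (x : ℝ), 0 ≤ wt i ^ x := fun i x => Real.rpow_nonneg (wt_pos i).le x
    have hw := ENNReal.ofReal_le_ofReal (wt_rpow_le hl htl n j)
    rw [ENNReal.ofReal_mul (mul_nonneg (by positivity) (mul_nonneg (hr _ _) (hr _ _))),
      ENNReal.ofReal_mul (by positivity), ENNReal.ofReal_mul (hr _ _),
      ENNReal.ofReal_add (add_nonneg (hi _) (hi _)) (hi _),
      ENNReal.ofReal_add (hi _) (hi _)] at hw
    rw [enorm_mul]
    refine (mul_le_mul_left hw _).trans (le_of_eq ?_)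
    ring
  refine (ENNReal.tsum_le_tsum hpoint).trans ?_
  rw [ENNReal.tsum_mul_left]
  calc _ ≤ D ^ 2 * (10 * (Γ * (sobSq l b * sobSq t w))) := by
        gcongr
        exact h
    _ = _ := by ring

lemma sobSq_mono {s t : ℝ} (h : s ≤ t) (u : ℤ → ℂ) : sobSq s u ≤ sobSq t u := by
  unfold sobSq
  gcongr with j
  exact one_le_wt j

lemma sobSq_add_le (t : ℝ) (u v : ℤ → ℂ) :
    sobSq t (u + v) ≤ 2 * (sobSq t u + sobSq t v) := by
  unfold sobSq
  rw [← ENNReal.tsum_add, ← ENNReal.tsum_mul_left]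
  refine ENNReal.tsum_le_tsum fun j => ?_
  refine le_trans ?_ (ENNReal.add_sq_le_two_mul _ _)
  rw [← mul_add, Pi.add_apply]
  gcongr
  exact enorm_add_le _ _

lemma sobSq_smul (t : ℝ) (z : ℂ) (u : ℤ → ℂ) :
    sobSq t (z • u) = ‖z‖ₑ ^ 2 * sobSq t u := by
  unfold sobSq
  rw [← ENNReal.tsum_mul_left]
  refine tsum_congr fun j => ?_
  rw [Pi.smul_apply, smul_eq_mul, enorm_mul]
  ring

lemma sobSq_zero (t : ℝ) : sobSq t 0 = 0 := by
  simp [sobSq]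

lemma exists_sobSq_sum_le {ι : Type*} {s t : ℝ} (S : Finset ι) (T : ι → (ℤ → ℂ) → ℤ → ℂ)
    (hT : ∀ i ∈ S, ∃ M : ℝ≥0, ∀ u, sobSq t (T i u) ≤ M * sobSq s u) :
    ∃ M : ℝ≥0, ∀ u, sobSq t (∑ i ∈ S, T i u) ≤ M * sobSq s u := by
  classical
  induction S using Finset.induction_on with
  | empty => exact ⟨0, fun u => by simp [sobSq_zero]⟩
  | insert i S hi ih =>
    obtain ⟨M, hM⟩ := ih fun r hr => hT r (Finset.mem_insert_of_mem hr)
    obtain ⟨K, hK⟩ := hT i (Finset.mem_insert_self i S)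
    refine ⟨2 * (K + M), fun u => ?_⟩
    rw [Finset.sum_insert hi]
    refine (sobSq_add_le _ _ _).trans ?_
    push_cast
    rw [mul_assoc, add_mul]
    gcongr
    exacts [hK u, hM u]

/-- A Fourier multiplier of order `r` is bounded from `H^s` to `H^(s-r)`. -/
lemma exists_sobSq_multiplier_le {s : ℝ} {r : ℕ} {m : ℤ → ℂ} {B : ℝ≥0}
    (hm : ∀ j, ‖m j‖ ≤ B * wt j ^ r) (u : ℤ → ℂ) :
    sobSq (s - r) (fun j => m j * u j) ≤ (B ^ 2 : ℝ≥0) * sobSq s u := by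
  unfold sobSq
  rw [← ENNReal.tsum_mul_left]
  refine ENNReal.tsum_le_tsum fun j => ?_
  rw [ENNReal.coe_pow, ← mul_pow, enorm_mul, ← mul_assoc, ← mul_assoc]
  refine pow_le_pow_left' (mul_le_mul' ?_ le_rfl) 2
  have hr : 0 ≤ wt j ^ (s - r) := Real.rpow_nonneg (wt_pos j).le _
  rw [← ENNReal.ofReal_coe_nnreal, ← ofReal_norm, ← ENNReal.ofReal_mul hr,
    ← ENNReal.ofReal_mul B.coe_nonneg]
  apply ENNReal.ofReal_le_ofReal
  calc wt j ^ (s - r) * ‖m j‖ ≤ wt j ^ (s - r) * (B * wt j ^ r) := by gcongr; exact hm j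
    _ = B * (wt j ^ (s - r) * wt j ^ (r : ℝ)) := by rw [Real.rpow_natCast]; ring
    _ = B * wt j ^ s := by rw [← Real.rpow_add (wt_pos j), sub_add_cancel]

lemma norm_I_mul_pow_le (r : ℕ) (j : ℤ) : ‖(Complex.I * (j : ℂ)) ^ r‖ ≤ wt j ^ r := by
  rw [norm_pow, norm_mul, Complex.norm_I, one_mul, Complex.norm_intCast]
  exact pow_le_pow_left₀ (abs_nonneg _) (abs_le_wt j) r

lemma exists_sobSq_L0op_le (s : ℝ) (q k : ℕ) (c : ℕ → ℂ) :
    ∃ M : ℝ≥0, ∀ u, sobSq (s - k) (L0op q k c u) ≤ M * sobSq s u := by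
  refine ⟨(∑ r ∈ Finset.Icc q k, ‖c r‖₊) ^ 2, fun u => exists_sobSq_multiplier_le (fun j => ?_) u⟩
  unfold symb
  push_cast
  rw [Finset.sum_mul]
  refine (norm_sum_le _ _).trans (Finset.sum_le_sum fun r hr => ?_)
  rw [norm_mul]
  gcongr
  exact (norm_I_mul_pow_le r j).trans
    (pow_le_pow_right₀ (one_le_wt j) (Finset.mem_Icc.1 hr).2)

lemma exists_tsum_L1op_term_le {s : ℝ} {p l r : ℕ} (hr : r ≤ p) {b : ℤ → ℂ}
    (hb : hsumm (l : ℝ) b) (hl : 1 ≤ (l : ℝ)) (hsl : |s - p| ≤ l) :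
    ∃ C : ℝ≥0, ∀ u : ℤ → ℂ, ∑' n, (ENNReal.ofReal (wt n ^ (s - p)) *
      ∑' j : ℤ, ‖b (n - j) * (Complex.I * (j : ℂ)) ^ r * u j‖ₑ) ^ 2 ≤ C * sobSq s u := by
  obtain ⟨C, hC⟩ := exists_tsum_conv_le hl hsl hb
  refine ⟨C, fun u => ?_⟩
  simp_rw [mul_assoc (b _)]
  refine (hC fun j => (Complex.I * (j : ℂ)) ^ r * u j).trans ?_
  gcongr
  have h := exists_sobSq_multiplier_le (s := s) (r := p) (B := 1)
    (m := fun j => (Complex.I * (j : ℂ)) ^ r) (fun j => ?_) u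
  · simpa using h
  · rw [NNReal.coe_one, one_mul]
    exact (norm_I_mul_pow_le r j).trans (pow_le_pow_right₀ (one_le_wt j) hr)

lemma exists_sobSq_L1op_le {s : ℝ} {p l : ℕ} {a : ℕ → ℤ → ℂ}
    (ha : ∀ r, r ≤ p → hsumm (l : ℝ) (a r)) (hl : 1 ≤ (l : ℝ)) (hsl : |s - p| ≤ l) :
    ∃ M : ℝ≥0, ∀ u, sobSq (s - p) (L1op p a u) ≤ M * sobSq s u := by
  have h := exists_sobSq_sum_le (s := s) (t := s - p) (Finset.range (p + 1))
    (fun r u n => ∑' j : ℤ, a r (n - j) * (Complex.I * (j : ℂ)) ^ r * u j) fun r hr => by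
      have hr := Nat.lt_succ_iff.1 (Finset.mem_range.1 hr)
      obtain ⟨C, hC⟩ := exists_tsum_L1op_term_le (s := s) hr (ha r hr) hl hsl
      refine ⟨C, fun u => le_trans ?_ (hC u)⟩
      unfold sobSq
      gcongr
      exact enorm_tsum_le_tsum_enorm
  obtain ⟨M, hM⟩ := h
  refine ⟨M, fun u => ?_⟩
  have hu : L1op p a u = ∑ r ∈ Finset.range (p + 1), fun n : ℤ =>
      ∑' j : ℤ, a r (n - j) * (Complex.I * (j : ℂ)) ^ r * u j := by
    ext n
    simp [L1op]
  rw [hu]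
  exact hM u

lemma summable_L1op_term {s : ℝ} {p l r : ℕ} (hr : r ≤ p) {b : ℤ → ℂ}
    (hb : hsumm (l : ℝ) b) (hl : 1 ≤ (l : ℝ)) (hsl : |s - p| ≤ l) {u : ℤ → ℂ}
    (hu : hsumm s u) (n : ℤ) :
    Summable fun j : ℤ => b (n - j) * (Complex.I * (j : ℂ)) ^ r * u j := by
  obtain ⟨C, hC⟩ := exists_tsum_L1op_term_le (s := s) hr hb hl hsl
  have htop := ne_top_of_le_ne_top
    (ENNReal.mul_ne_top ENNReal.coe_ne_top (hsumm_iff_sobSq_ne_top.1 hu)) (hC u)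
  have hn := ENNReal.ne_top_of_tsum_ne_top htop n
  have hw : ENNReal.ofReal (wt n ^ (s - p)) ≠ 0 := by
    simpa using Real.rpow_pos_of_pos (wt_pos n) _
  rw [← summable_norm_iff]
  have hfin : ∑' j : ℤ, ‖b (n - j) * (Complex.I * (j : ℂ)) ^ r * u j‖ₑ ≠ ⊤ := by
    intro h
    rw [h, ENNReal.mul_top hw] at hn
    simp at hn
  simpa using ENNReal.summable_toReal hfin

lemma L1op_add {s : ℝ} {p l : ℕ} {a : ℕ → ℤ → ℂ}
    (ha : ∀ r, r ≤ p → hsumm (l : ℝ) (a r)) (hl : 1 ≤ (l : ℝ)) (hsl : |s - p| ≤ l)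
    {u v : ℤ → ℂ} (hu : hsumm s u) (hv : hsumm s v) :
    L1op p a (u + v) = L1op p a u + L1op p a v := by
  ext n
  simp only [L1op, Pi.add_apply]
  rw [← Finset.sum_add_distrib]
  refine Finset.sum_congr rfl fun r hr => ?_
  have hr := Nat.lt_succ_iff.1 (Finset.mem_range.1 hr)
  rw [← (summable_L1op_term hr (ha r hr) hl hsl hu n).tsum_add
    (summable_L1op_term hr (ha r hr) hl hsl hv n)]
  exact tsum_congr fun j => mul_add _ _ _

lemma L1op_smul (p : ℕ) (a : ℕ → ℤ → ℂ) (z : ℂ) (u : ℤ → ℂ) :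
    L1op p a (z • u) = z • L1op p a u := by
  ext n
  simp only [L1op, Pi.smul_apply, smul_eq_mul, Finset.mul_sum]
  refine Finset.sum_congr rfl fun r _ => ?_
  rw [← tsum_mul_left]
  exact tsum_congr fun j => by ring

/-- The weight multiplier `u_j ↦ max(1,|j|)^s u_j`, an isometry from `H^(t+s)` onto `H^t`. -/
def weightMul (s : ℝ) (u : ℤ → ℂ) : ℤ → ℂ := fun j => ((wt j ^ s : ℝ) : ℂ) * u j

lemma sobSq_weightMul (s t : ℝ) (u : ℤ → ℂ) : sobSq t (weightMul s u) = sobSq (t + s) u := by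
  refine tsum_congr fun j => ?_
  have hw : ∀ x : ℝ, 0 ≤ wt j ^ x := fun x => Real.rpow_nonneg (wt_pos j).le x
  rw [weightMul, enorm_mul, ← mul_assoc, ← ofReal_norm (((wt j ^ s : ℝ) : ℂ)), Complex.norm_real,
    Real.norm_of_nonneg (hw s), ← ENNReal.ofReal_mul (hw t), ← Real.rpow_add (wt_pos j)]

lemma hsumm_weightMul {s t : ℝ} {u : ℤ → ℂ} : hsumm t (weightMul s u) ↔ hsumm (t + s) u := by
  rw [hsumm_iff_sobSq_ne_top, hsumm_iff_sobSq_ne_top, sobSq_weightMul]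

lemma hnorm_weightMul (s t : ℝ) (u : ℤ → ℂ) : hnorm t (weightMul s u) = hnorm (t + s) u := by
  rw [hnorm_eq_sqrt_sobSq, hnorm_eq_sqrt_sobSq, sobSq_weightMul]

lemma weightMul_weightMul {s t : ℝ} (h : s + t = 0) (u : ℤ → ℂ) :
    weightMul s (weightMul t u) = u := by
  ext j
  rw [weightMul, weightMul, ← mul_assoc, ← Complex.ofReal_mul, ← Real.rpow_add (wt_pos j), h,
    Real.rpow_zero, Complex.ofReal_one, one_mul]

lemma weightMul_add (s : ℝ) (u v : ℤ → ℂ) :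
    weightMul s (u + v) = weightMul s u + weightMul s v := by
  ext j
  simp [weightMul, mul_add]

lemma weightMul_smul (s : ℝ) (z : ℂ) (u : ℤ → ℂ) :
    weightMul s (z • u) = z • weightMul s u := by
  ext j
  simp only [weightMul, Pi.smul_apply, smul_eq_mul]
  ring

lemma memℓp_two_iff_hsumm {u : ℤ → ℂ} : Memℓp u 2 ↔ hsumm 0 u := by
  rw [memℓp_gen_iff (by norm_num)]
  simp [hsumm]

lemma lp_norm_eq_hnorm (x : lp (fun _ : ℤ => ℂ) 2) : ‖x‖ = hnorm 0 x := by
  rw [lp.norm_eq_tsum_rpow (by norm_num), hnorm, Real.sqrt_eq_rpow]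
  simp

/-- The bounded inverse theorem for operators between Sobolev spaces of sequences. -/
lemma exists_hnorm_inverse_le {s t : ℝ} {T R : (ℤ → ℂ) → ℤ → ℂ} {M : ℝ≥0}
    (hadd : ∀ u v, hsumm s u → hsumm s v → T (u + v) = T u + T v)
    (hsmul : ∀ (z : ℂ) u, T (z • u) = z • T u)
    (hM : ∀ u, sobSq t (T u) ≤ M * sobSq s u)
    (hR : ∀ f, hsumm t f → hsumm s (R f)) (hTR : ∀ f, hsumm t f → T (R f) = f)
    (hRT : ∀ u, hsumm s u → R (T u) = u) :
    ∃ C : ℝ, 0 ≤ C ∧ ∀ f, hsumm t f → hnorm s (R f) ≤ C * hnorm t f := by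
  have hT : ∀ u, hsumm s u → hsumm t (T u) := fun u hu =>
    hsumm_iff_sobSq_ne_top.2 (ne_top_of_le_ne_top
      (ENNReal.mul_ne_top ENNReal.coe_ne_top (hsumm_iff_sobSq_ne_top.1 hu)) (hM u))
  have hdown : ∀ (r : ℝ) (x : lp (fun _ : ℤ => ℂ) 2), hsumm r (weightMul (-r) x) := fun r x => by
    rw [hsumm_weightMul, add_neg_cancel, ← memℓp_two_iff_hsumm]
    exact lp.memℓp x
  have hup : ∀ (r : ℝ) (u : ℤ → ℂ), hsumm r u → Memℓp (weightMul r u) 2 := fun r u hu => by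
    rwa [memℓp_two_iff_hsumm, hsumm_weightMul, zero_add]
  let A₀ : lp (fun _ : ℤ => ℂ) 2 →ₗ[ℂ] lp (fun _ : ℤ => ℂ) 2 :=
    { toFun := fun x => ⟨weightMul t (T (weightMul (-s) x)), hup t _ (hT _ (hdown s x))⟩
      map_add' := fun x y => by
        ext1
        simp only [lp.coeFn_add, weightMul_add]
        rw [hadd _ _ (hdown s x) (hdown s y), weightMul_add]
      map_smul' := fun z x => by
        ext1
        simp only [lp.coeFn_smul, weightMul_smul, hsmul, RingHom.id_apply] }
  have hA₀ : ∀ x, ‖A₀ x‖ ≤ Real.sqrt M * ‖x‖ := fun x => by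
    rw [lp_norm_eq_hnorm, lp_norm_eq_hnorm]
    change hnorm 0 (weightMul t (T (weightMul (-s) x))) ≤ _
    have hx : hnorm 0 x = hnorm s (weightMul (-s) x) := by
      rw [hnorm_weightMul, add_neg_cancel]
    rw [hnorm_weightMul, zero_add, hx]
    refine hnorm_le_of_sobSq_le (Real.sqrt_nonneg _) (hdown s x) ?_
    rw [Real.sq_sqrt M.coe_nonneg, ENNReal.ofReal_coe_nnreal]
    exact hM _
  let A := A₀.mkContinuous _ hA₀
  have hAR : ∀ f (hf : hsumm t f), A ⟨weightMul s (R f), hup s _ (hR f hf)⟩ =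
      ⟨weightMul t f, hup t f hf⟩ := fun f hf => by
    ext1
    change weightMul t (T (weightMul (-s) (weightMul s (R f)))) = weightMul t f
    rw [weightMul_weightMul (neg_add_cancel s), hTR f hf]
  have hinj : Function.Injective A := fun x y hxy => by
    have h : weightMul t (T (weightMul (-s) x)) = weightMul t (T (weightMul (-s) y)) :=
      congrArg Subtype.val hxy
    have h₁ := congrArg (fun u => R (weightMul (-t) u)) h
    simp only [weightMul_weightMul (neg_add_cancel t)] at h₁
    rw [hRT _ (hdown s x), hRT _ (hdown s y)] at h₁
    have h₂ := congrArg (weightMul s) h₁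
    rw [weightMul_weightMul (add_neg_cancel s), weightMul_weightMul (add_neg_cancel s)] at h₂
    exact Subtype.ext h₂
  have hsurj : Function.Surjective A := fun y => by
    refine ⟨_, (hAR _ (hdown t y)).trans (Subtype.ext ?_)⟩
    exact weightMul_weightMul (add_neg_cancel t) _
  let e := ContinuousLinearEquiv.ofBijective A (LinearMap.ker_eq_bot.2 hinj)
    (LinearMap.range_eq_top.2 hsurj)
  refine ⟨‖(e.symm : lp (fun _ : ℤ => ℂ) 2 →L[ℂ] lp (fun _ : ℤ => ℂ) 2)‖, norm_nonneg _,
    fun f hf => ?_⟩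
  have h := (e.symm : lp (fun _ : ℤ => ℂ) 2 →L[ℂ] lp (fun _ : ℤ => ℂ) 2).le_opNorm
    ⟨weightMul t f, hup t f hf⟩
  have he : e.symm ⟨weightMul t f, hup t f hf⟩ = ⟨weightMul s (R f), hup s _ (hR f hf)⟩ := by
    rw [ContinuousLinearEquiv.symm_apply_eq]
    exact (hAR f hf).symm
  rw [ContinuousLinearEquiv.coe_coe, he, lp_norm_eq_hnorm, lp_norm_eq_hnorm] at h
  simpa only [hnorm_weightMul, zero_add] using h

lemma L0op_add (q k : ℕ) (c : ℕ → ℂ) (u v : ℤ → ℂ) :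
    L0op q k c (u + v) = L0op q k c u + L0op q k c v := by
  ext j
  simp [L0op, mul_add]

lemma L0op_smul (q k : ℕ) (c : ℕ → ℂ) (z : ℂ) (u : ℤ → ℂ) :
    L0op q k c (z • u) = z • L0op q k c u := by
  ext j
  simp only [L0op, Pi.smul_apply, smul_eq_mul]
  ring

lemma exists_sobSq_pencil_le {s : ℝ} {q k p l : ℕ} (hpk : p < k) (c : ℕ → ℂ)
    {a : ℕ → ℤ → ℂ} (ha : ∀ r, r ≤ p → hsumm (l : ℝ) (a r)) (hl : 1 ≤ (l : ℝ))
    (hsl : |s - p| ≤ l) (z : ℂ) :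
    ∃ M : ℝ≥0, ∀ u,
      sobSq (s - k) (z • u - (L0op q k c u + L1op p a u)) ≤ M * sobSq s u := by
  obtain ⟨M₀, h₀⟩ := exists_sobSq_L0op_le s q k c
  obtain ⟨M₁, h₁⟩ := exists_sobSq_L1op_le ha hl hsl
  have hpk' : (p : ℝ) ≤ k := by exact_mod_cast hpk.le
  refine ⟨2 * (‖z‖₊ ^ 2 + 2 * (M₀ + M₁)), fun u => ?_⟩
  have hneg : z • u - (L0op q k c u + L1op p a u) =
      z • u + (-1 : ℂ) • (L0op q k c u + L1op p a u) := by
    rw [neg_one_smul, sub_eq_add_neg]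
  rw [hneg]
  refine (sobSq_add_le _ _ _).trans ?_
  rw [sobSq_smul, sobSq_smul, enorm_neg, enorm_one, one_pow, one_mul]
  push_cast
  rw [mul_assoc, add_mul, mul_assoc, add_mul]
  gcongr
  · rfl
  · exact sobSq_mono (by linarith [k.cast_nonneg (α := ℝ)]) u
  · refine (sobSq_add_le _ _ _).trans ?_
    gcongr
    · exact h₀ u
    · exact (sobSq_mono (by linarith) _).trans (h₁ u)

lemma hnorm_le_opNorm_mul {s t : ℝ} {T : (ℤ → ℂ) → ℤ → ℂ}
    (hT : ∃ C : ℝ, 0 ≤ C ∧ ∀ u, hsumm s u → hnorm t (T u) ≤ C * hnorm s u) {u : ℤ → ℂ}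
    (hu : hsumm s u) : hnorm t (T u) ≤ opNorm s t T * hnorm s u := by
  have hs : 0 ≤ hnorm s u := Real.sqrt_nonneg _
  rcases hs.eq_or_lt with h | h
  · obtain ⟨C, -, hC⟩ := hT
    have := hC u hu
    rwa [← h, mul_zero] at this ⊢
  · rw [← div_le_iff₀ h]
    exact le_csInf hT fun C hC => (div_le_iff₀ h).2 (hC.2 u hu)

lemma half_le_wt_of_notMem {N : ℕ} {j : ℤ} (h : ¬(-Nmin N ≤ j ∧ j ≤ Npl N)) :
    (N : ℝ) / 2 ≤ wt j := by
  have h2 : (N : ℤ) ≤ 2 * |j| := by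
    unfold Nmin Npl at h
    rcases abs_cases j with ⟨h₁, h₂⟩ | ⟨h₁, h₂⟩ <;> omega
  have h3 : (N : ℝ) ≤ 2 * |(j : ℝ)| := by exact_mod_cast h2
  linarith [abs_le_wt j]

/-- The Fourier tail `g - 𝒫_N g` gains a factor `(N/2)^(p-k)` in passing from `H^(s-p)` to
`H^(s-k)`. -/
lemma sobSq_sub_projP_le {s : ℝ} {p k N : ℕ} (hpk : p ≤ k) (hN : 1 ≤ N) (g : ℤ → ℂ) :
    sobSq (s - k) (projP N g - g) ≤
      ENNReal.ofReal (((2 / (N : ℝ)) ^ (k - p)) ^ 2) * sobSq (s - p) g := by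
  unfold sobSq
  rw [← ENNReal.tsum_mul_left]
  refine ENNReal.tsum_le_tsum fun j => ?_
  have hN0 : (0 : ℝ) < N := by exact_mod_cast hN
  by_cases h : -Nmin N ≤ j ∧ j ≤ Npl N
  · simp [projP, h]
  · have hj : (projP N g - g) j = -g j := by simp [projP, h]
    have hw := wt_pos j
    rw [hj, enorm_neg, ENNReal.ofReal_pow (by positivity), ← mul_pow, ← mul_assoc]
    refine pow_le_pow_left' (mul_le_mul' ?_ le_rfl) 2
    rw [← ENNReal.ofReal_mul (by positivity)]
    apply ENNReal.ofReal_le_ofReal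
    have hexp : s - (k : ℝ) = (s - p) - ((k - p : ℕ) : ℝ) := by
      rw [Nat.cast_sub hpk]
      ring
    rw [hexp, Real.rpow_sub hw, Real.rpow_natCast, div_eq_inv_mul, ← inv_pow]
    gcongr
    rw [← inv_div]
    exact inv_anti₀ (by positivity) (half_le_wt_of_notMem h)

lemma hsumm_of_inPN {N : ℕ} {v : ℤ → ℂ} (hv : inPN N v) (s : ℝ) : hsumm s v := by
  refine summable_of_ne_finset_zero (s := Finset.Icc (-Nmin N) (Npl N)) fun j hj => ?_
  have h0 : v j = 0 := by
    rw [← congrFun hv j, projP, if_neg (by simpa using hj)]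
  simp [h0]

lemma hnorm_pos {s : ℝ} {v : ℤ → ℂ} (hv : hsumm s v) (h : v ≠ 0) : 0 < hnorm s v := by
  obtain ⟨j, hj⟩ := Function.ne_iff.1 h
  refine Real.sqrt_pos.2 (hv.tsum_pos (weighted_sq_nonneg s v) j ?_)
  exact mul_pos (pow_pos (norm_pos_iff.2 hj) 2) (Real.rpow_pos_of_pos (wt_pos j) _)

/-- For `N > c ε^{1/(p-k)}`, no eigenvalue of `𝓛₀ + 𝒫_N 𝓛₁`
restricted to `ran 𝒫_N` lies in `ρ_ε(𝓛; H^s, H^{s-k})`, the complement of the closure of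
the set of points where the resolvent fails to exist or has norm `> ε⁻¹`; equivalently,
every such eigenvalue lies in the `ε`-pseudospectrum `σ_ε(𝓛; H^s, H^{s-k})`. -/
theorem eigenvalues_enter_pseudospectrum
    (s : ℝ) (q k p l : ℕ) (hqk : q ≤ k) (hpk : p < k) (hl : 1 ≤ l)
    (c : ℕ → ℂ) (hck : c k ≠ 0)
    (a : ℕ → ℤ → ℂ) (ha : ∀ r, r ≤ p → hsumm (l : ℝ) (a r))
    (ζ : ℂ) (hζ : zetaGood q k c ζ)
    (hlreg : max (max |s - (p : ℝ)| (p : ℝ)) 1 ≤ (l : ℝ)) :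
    ∃ ccst : ℝ, 0 < ccst ∧
      ∀ ε : ℝ, 0 < ε → ∀ N : ℕ, 1 ≤ N → ccst * ε ^ (1 / ((p : ℝ) - (k : ℝ))) < (N : ℝ) →
        ∀ (lam : ℂ) (v : ℤ → ℂ), v ≠ 0 → inPN N v →
          L0op q k c v + projP N (L1op p a v) = lam • v →
          lam ∈ closure {z : ℂ | ¬ resolventBounded q k p c a s ε z} := by
  have hl' : 1 ≤ (l : ℝ) := (le_max_right _ _).trans hlreg
  have hsl : |s - p| ≤ l := (le_max_left _ _).trans ((le_max_left _ _).trans hlreg)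
  obtain ⟨M, hM⟩ := exists_sobSq_L1op_le ha hl' hsl
  set K := Real.sqrt M with hK
  have hK0 : 0 ≤ K := Real.sqrt_nonneg _
  refine ⟨2 * (K + 1), by positivity, fun ε hε N hN hNε lam v hv0 hv heig => ?_⟩
  refine subset_closure ?_
  rintro ⟨R, hR, hRL, hnorm_R⟩
  have hvs := hsumm_of_inPN hv s
  have hN0 : (0 : ℝ) < N := by exact_mod_cast hN
  obtain ⟨B, hB⟩ := exists_sobSq_pencil_le (q := q) hpk c ha hl' hsl lam
  have hbdd := exists_hnorm_inverse_le (R := R)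
    (T := fun u => lam • u - (L0op q k c u + L1op p a u))
    (fun u w hu hw => by
      rw [smul_add, L0op_add, L1op_add ha hl' hsl hu hw]
      abel)
    (fun z u => by
      rw [L0op_smul, L1op_smul, smul_comm, smul_sub, smul_add])
    hB (fun f hf => (hR f hf).1) (fun f hf => (hR f hf).2) hRL
  have hres : lam • v - (L0op q k c v + L1op p a v) =
      projP N (L1op p a v) - L1op p a v := by
    rw [← heig]
    abel
  have hL1 : hsumm (s - p) (L1op p a v) :=
    hsumm_iff_sobSq_ne_top.2 (ne_top_of_le_ne_top
      (ENNReal.mul_ne_top ENNReal.coe_ne_top (hsumm_iff_sobSq_ne_top.1 hvs)) (hM v))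
  have htail := sobSq_sub_projP_le (s := s) hpk.le hN (L1op p a v)
  have hg : hsumm (s - k) (projP N (L1op p a v) - L1op p a v) :=
    hsumm_iff_sobSq_ne_top.2 (ne_top_of_le_ne_top
      (ENNReal.mul_ne_top ENNReal.ofReal_ne_top (hsumm_iff_sobSq_ne_top.1 hL1)) htail)
  have hRg : R (projP N (L1op p a v) - L1op p a v) = v := by
    rw [← hres]
    exact hRL v hvs
  have hpos := hnorm_pos hvs hv0
  have h₁ := hnorm_le_opNorm_mul hbdd hg
  rw [hRg] at h₁
  have h₂ := hnorm_le_of_sobSq_le (by positivity) hL1 htail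
  have h₃ : hnorm (s - p) (L1op p a v) ≤ K * hnorm s v := by
    refine hnorm_le_of_sobSq_le hK0 hvs ?_
    rw [hK, Real.sq_sqrt M.coe_nonneg, ENNReal.ofReal_coe_nnreal]
    exact hM v
  have h₄ : 1 * hnorm s v ≤ ε⁻¹ * ((2 / (N : ℝ)) ^ (k - p) * K) * hnorm s v :=
    calc 1 * hnorm s v ≤ ε⁻¹ * ((2 / (N : ℝ)) ^ (k - p) * (K * hnorm s v)) := by
          rw [one_mul]
          refine h₁.trans ?_
          refine mul_le_mul hnorm_R (h₂.trans ?_) (Real.sqrt_nonneg _) (by positivity)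
          gcongr
      _ = _ := by ring
  have h₅ := le_of_mul_le_mul_right h₄ hpos
  have hd : k - p ≠ 0 := by omega
  have hpow : (2 * (K + 1)) ^ (k - p) * ε⁻¹ < (N : ℝ) ^ (k - p) := by
    have h := pow_lt_pow_left₀ hNε (by positivity) hd
    rw [mul_pow, ← Real.rpow_mul_natCast hε.le] at h
    have hexp : 1 / ((p : ℝ) - k) * ((k - p : ℕ) : ℝ) = -1 := by
      have hne : (p : ℝ) - k ≠ 0 := sub_ne_zero.2 (by exact_mod_cast hpk.ne)
      rw [Nat.cast_sub hpk.le]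
      field_simp
      ring
    rwa [hexp, Real.rpow_neg_one] at h
  have hK1 : K < (K + 1) ^ (k - p) :=
    (lt_add_one K).trans_le (le_self_pow₀ (by linarith) hd)
  have h₆ : ε⁻¹ * ((2 / (N : ℝ)) ^ (k - p) * K) < 1 :=
    calc ε⁻¹ * ((2 / (N : ℝ)) ^ (k - p) * K)
        ≤ ε⁻¹ * ((2 / (N : ℝ)) ^ (k - p) * (K + 1) ^ (k - p)) := by gcongr
      _ = (2 * (K + 1)) ^ (k - p) * ε⁻¹ / (N : ℝ) ^ (k - p) := by
          rw [div_pow, mul_pow]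
          ring
      _ < 1 := (div_lt_one (by positivity)).2 hpow
  exact absurd h₅ (not_le.2 h₆)

end
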